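/- arXiv:1609.03398 — 3 statements merged into one kernel-verified Lean document; each statement's English description precedes it below -/
import Mathlib

section
/- Let p ≥ 3 be prime, let k be a positive integer with p ∤ k, let φ(x) = x^p + kp·x^{p−1} − kp ∈ ℤ[x], and let a = −k(p−1). Fix n ≥ 1. If φ^n(a) ≠ k·y² for every y ∈ ℤ, then Gal(K_n/K_{n−1}) is maximal, i.e. has order (p!)^{p^{n−1}}. -/
open Polynomial

noncomputable section

/-- The `n`-th iterate of a polynomial under composition: `polyIter φ 0 = X`,
`polyIter φ (n+1) = φ ∘ (polyIter φ n)`. -/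
def polyIter {R : Type*} [CommRing R] (φ : Polynomial R) : ℕ → Polynomial R
  | 0 => X
  | n + 1 => φ.comp (polyIter φ n)

/-- The splitting field `K_n` of the `n`-th iterate of `φ ∈ ℤ[x]` over `ℚ`, inside a fixed
algebraic closure of `ℚ`. -/
def Kfield (φ : Polynomial ℤ) (n : ℕ) : IntermediateField ℚ (AlgebraicClosure ℚ) :=
  IntermediateField.adjoin ℚ ((polyIter φ n).rootSet (AlgebraicClosure ℚ))

/-- The order of `Gal(K_n / K_{n-1})`: the number of automorphisms of `K_n` over `ℚ`
fixing every element of `K_{n-1}` pointwise. -/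
def relGalCard (φ : Polynomial ℤ) (n : ℕ) : ℕ :=
  Nat.card {σ : Kfield φ n ≃ₐ[ℚ] Kfield φ n //
    ∀ (x : AlgebraicClosure ℚ) (_ : x ∈ Kfield φ (n - 1)) (hx' : x ∈ Kfield φ n),
      σ ⟨x, hx'⟩ = ⟨x, hx'⟩}

end

section GroupTheory

open Equiv MulAction

variable {G X Y : Type*} [Group G] [MulAction G X] [MulAction G Y]

/-- A subgroup of permutations containing every transposition within the fibres of `f` contains
every permutation preserving the fibres of `f`. -/
theorem mem_of_forall_swap_mem_of_comp_eq [Finite X] [DecidableEq X] {f : X → Y}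
    {H : Subgroup (Perm X)}
    (hH : ∀ u v, f u = f v → swap u v ∈ H) {π : Perm X} (hπ : ∀ x, f (π x) = f x) : π ∈ H := by
  let S : Set (Perm X) := {τ | ∃ u v, u ≠ v ∧ f u = f v ∧ τ = swap u v}
  have hS : ∀ τ ∈ S, τ.IsSwap := by
    rintro τ ⟨u, v, huv, -, rfl⟩
    exact ⟨u, v, huv, rfl⟩
  have hle : Subgroup.closure S ≤ H := by
    rw [Subgroup.closure_le]
    rintro τ ⟨u, v, -, h, rfl⟩
    exact hH u v h
  refine hle ((mem_closure_isSwap hS).2 ⟨Set.toFinite _, fun x ↦ ?_⟩)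
  by_cases hx : π x = x
  · rw [hx]
    exact mem_orbit_self x
  · exact ⟨⟨swap x (π x), Subgroup.subset_closure ⟨x, π x, Ne.symm hx, (hπ x).symm, rfl⟩⟩,
      swap_apply_left x (π x)⟩

/-- Let `G` act faithfully and transitively on `X`, a set of cardinality a power of a prime `p`,
compatibly with `f : X → Y` all of whose fibres have `p ≥ 3` elements. If some element of `G` acts
on `X` as a transposition, then the kernel of the action on `Y` contains every permutation
preserving the fibres of `f`, so it has order `(p!) ^ |Y|`. -/
theorem card_fixing_eq_factorial_pow [Finite X] [Finite Y] [FaithfulSMul G X]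
    [IsPretransitive G X] [DecidableEq X] {f : X → Y} (hf : ∀ (g : G) x, f (g • x) = g • f x)
    {p m : ℕ} (hp : p.Prime) (hp3 : 3 ≤ p) (hfib : ∀ y, Nat.card {x // f x = y} = p)
    (hX : Nat.card X = p ^ m) {σ : G} {x y : X} (hxy : x ≠ y) (hσ : ∀ z, σ • z = swap x y z) :
    Nat.card {g : G // ∀ y : Y, g • y = y} = p.factorial ^ Nat.card Y := by
  classical
  have := Fintype.ofFinite X
  have := Fintype.ofFinite Y
  have fsurj : Function.Surjective f := fun b ↦ by
    have : Nat.card {x // f x = b} ≠ 0 := by rw [hfib]; exact hp.ne_zero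
    obtain ⟨⟨x, hx⟩⟩ := (Nat.card_ne_zero.1 this).1
    exact ⟨x, hx⟩
  have hfxy : f x = f y := by
    have h3 : 2 < Fintype.card {z // f z = f x} := by
      rw [← Nat.card_eq_fintype_card, hfib]; omega
    obtain ⟨z, hzx, hzy⟩ : ∃ z, f z = f x ∧ z ≠ x ∧ z ≠ y := by
      by_contra! hcon
      have : (Finset.univ.filter fun z ↦ f z = f x) ⊆ {x, y} := by
        intro z hz
        have := hcon z (Finset.mem_filter.1 hz).2
        simp only [Finset.mem_insert, Finset.mem_singleton]
        tauto
      have := (Finset.card_le_card this).trans Finset.card_le_two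
      rw [Fintype.card_subtype] at h3
      omega
    have h1 : σ • z = z := by rw [hσ, swap_apply_of_ne_of_ne hzy.1 hzy.2]
    have h2 : σ • x = y := by rw [hσ, swap_apply_left]
    rw [← h2, hf, ← hzx, ← hf, h1]
  let N : Subgroup G := (toPermHom G Y).ker
  have memN (g : G) : g ∈ N ↔ ∀ y : Y, g • y = y := by
    simp [N, MonoidHom.mem_ker, Equiv.ext_iff]
  let H : Subgroup (Perm X) := N.map (toPermHom G X)
  have Hf {π : Perm X} (hπ : π ∈ H) (z : X) : f (π z) = f z := by
    obtain ⟨g, hg, rfl⟩ := hπ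
    simp [hf, (memN g).1 hg]
  have Hconj (g : G) {u v : X} (h : swap u v ∈ H) : swap (g • u) (g • v) ∈ H := by
    obtain ⟨τ, hτ, h⟩ := h
    refine ⟨g * τ * g⁻¹, (inferInstance : N.Normal).conj_mem τ hτ g, ?_⟩
    rw [map_mul, map_mul, h, map_inv]
    exact (Equiv.swap_apply_apply (toPermHom G X g) u v).symm
  have hmem : swap x y ∈ H := by
    have hσ' : toPermHom G X σ = swap x y := Equiv.ext hσ
    refine ⟨σ, (memN σ).2 fun b ↦ ?_, hσ'⟩
    obtain ⟨z, rfl⟩ := fsurj b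
    rw [← hf, hσ, swap_apply_def]
    split_ifs with h1 h2 <;> simp_all
  let s : Setoid X :=
    { r := fun u v ↦ swap u v ∈ H
      iseqv := ⟨fun u ↦ by rw [swap_self]; exact H.one_mem, fun {u v} h ↦ by rwa [swap_comm],
        fun {u v w} h h' ↦ SubmonoidClass.swap_mem_trans H h h'⟩ }
  let d : ℕ := Nat.card {v // swap x v ∈ H}
  have hd (u : X) : Nat.card {v // swap u v ∈ H} = d := by
    obtain ⟨g, rfl⟩ := exists_smul_eq G x u
    refine (Nat.card_congr ((toPerm g).subtypeEquiv fun v ↦ ⟨Hconj g, fun h ↦ ?_⟩)).symm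
    simpa using Hconj g⁻¹ h
  have hdX : d ∣ Nat.card X := by
    rw [← Nat.card_congr (Equiv.sigmaFiberEquiv (Quotient.mk s)), Nat.card_sigma]
    refine Finset.dvd_sum fun q _ ↦ ?_
    induction q using Quotient.inductionOn with
    | h u =>
      rw [← hd u]
      refine dvd_of_eq (Nat.card_congr (Equiv.subtypeEquivRight fun v ↦ ?_))
      rw [Quotient.eq]
      change _ ↔ swap v u ∈ H
      rw [swap_comm]
  have hsub (u : X) : {v | swap u v ∈ H} ⊆ {v | f v = f u} := fun v hv ↦ by
    simpa using Hf hv u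
  have hdp : d ≤ p := by
    rw [← hfib (f x)]
    exact Nat.card_mono (Set.toFinite _) (hsub x)
  have hd1 : 1 < d := by
    have : Nontrivial {v // swap x v ∈ H} :=
      ⟨⟨x, by rw [swap_self]; exact H.one_mem⟩, ⟨y, hmem⟩, by simpa using hxy⟩
    exact Finite.one_lt_card
  have hdp' : d = p := by
    obtain ⟨i, -, hi⟩ := (Nat.dvd_prime_pow hp).1 (hX ▸ hdX)
    refine le_antisymm hdp (Nat.le_of_dvd (by omega) ?_)
    rw [hi]
    refine dvd_pow_self p ?_
    rintro rfl
    simp [hi] at hd1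
  have hall (u v : X) (h : f u = f v) : swap u v ∈ H := by
    have : {v | swap u v ∈ H} = {v | f v = f u} :=
      Set.eq_of_subset_of_ncard_le (hsub u) (by
        have h1 := hd u
        have h2 := hfib (f u)
        rw [hdp', ← h2] at h1
        exact h1.ge) (Set.toFinite _)
    exact this.symm.subset h.symm
  have key : Nat.card {g : G // ∀ y : Y, g • y = y} = Nat.card {π : Perm X // f ∘ π = f} := by
    refine Nat.card_eq_of_bijective
      (fun g ↦ ⟨toPermHom G X g, funext fun z ↦ by simp [hf, g.2]⟩) ⟨fun g h hgh ↦ ?_, fun π ↦ ?_⟩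
    · exact Subtype.ext (toPerm_injective (congrArg Subtype.val hgh))
    · obtain ⟨g, hg, h⟩ := mem_of_forall_swap_mem_of_comp_eq hall (π := π.1) (congrFun π.2)
      exact ⟨⟨g, (memN g).1 hg⟩, Subtype.ext h⟩
  rw [key, Nat.card_eq_fintype_card, DomMulAct.stabilizer_card]
  simp [← Nat.card_eq_fintype_card, hfib]

end GroupTheory

section Inertia

open NumberField

/-- At a critical point `a`, a polynomial is constant modulo `(X - a) ^ 2`. -/
theorem exists_eq_sq_mul_add_C_of_derivative {R : Type*} [CommRing R] {P W : R[X]} {a : R}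
    (hW : derivative P = (X - C a) * W) :
    ∃ g : R[X], P = (X - C a) ^ 2 * g + C (P.eval a) ∧ 2 * g.eval a = W.eval a := by
  obtain ⟨q, hq⟩ := dvd_iff_isRoot.2 (show (P - C (P.eval a)).IsRoot a by simp)
  have h1 : derivative P = q + (X - C a) * derivative q := by
    rw [← sub_add_cancel P (C (P.eval a)), hq]
    simp
  obtain ⟨g, rfl⟩ := dvd_iff_isRoot.2 (show q.IsRoot a by
    simpa [hW] using (congrArg (eval a) h1).symm)
  refine ⟨g, by rw [← sub_add_cancel P (C (P.eval a)), hq]; simp; ring, ?_⟩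
  have h2 : (X - C a) * W = (X - C a) * (2 * g + (X - C a) * derivative g) := by
    rw [← hW, h1]
    simp
    ring
  rw [(monic_X_sub_C a).isRegular.left h2]
  simp

theorem multiset_prod_X_sub_C_dvd {S : Type*} [CommRing S] [IsDomain S] {p : S[X]} (hp : p ≠ 0)
    {s : Multiset S} (hs : s.Nodup) (h : ∀ x ∈ s, p.IsRoot x) :
    (s.map fun x ↦ X - C x).prod ∣ p := by
  rw [Multiset.prod_X_sub_C_dvd_iff_le_roots hp, Multiset.le_iff_subset hs]
  exact fun x hx ↦ (mem_roots hp).2 (h x hx)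

theorem aeval_intCast_eq {R : Type*} [CommRing R] (a : ℤ) (f : ℤ[X]) :
    aeval (a : R) f = ((f.eval a : ℤ) : R) := by
  simpa using aeval_algebraMap_apply R a f

/-- If exactly one pair of roots of `P` collides modulo a prime above `ℓ`, at a critical point `a`
at which `P a` has odd `ℓ`-adic valuation, then some Galois automorphism acts on the roots of `P`
as a transposition. -/
theorem exists_smul_eq_swap {L : Type} [Field L] [NumberField L] [IsGalois ℚ L] {P W : ℤ[X]}
    [DecidableEq (P.rootSet L)] [FaithfulSMul Gal(L/ℚ) (P.rootSet L)]
    (hP : P.Monic) (hsplit : (P.map (algebraMap ℤ L)).Splits) {a : ℤ}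
    (hW : derivative P = (X - C a) * W) {ℓ r : ℕ} (hℓ : ℓ.Prime) (hr : Odd r) {u : ℤ}
    (hu : ¬ (ℓ : ℤ) ∣ u) (hPa : P.eval a = (ℓ : ℤ) ^ r * u)
    (hroot : ∀ (F : Type) [CommRing F] [IsDomain F], (ℓ : F) = 0 → (aeval (a : F) P = 0) →
      ∀ x : F, aeval x P = 0 → aeval x W ≠ 0) :
    ∃ (σ : Gal(L/ℚ)) (x y : P.rootSet L), x ≠ y ∧ ∀ z, σ • z = Equiv.swap x y z := by
  classical
  have hℓZ : Prime (ℓ : ℤ) := Nat.prime_iff_prime_int.1 hℓ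
  let 𝔩 : Ideal ℤ := Ideal.span {(ℓ : ℤ)}
  have h𝔩0 : 𝔩 ≠ ⊥ := by simpa [𝔩] using hℓ.ne_zero
  have : 𝔩.IsPrime := (Ideal.span_singleton_prime hℓZ.ne_zero).2 hℓZ
  have : 𝔩.IsMaximal := this.isMaximal h𝔩0
  obtain ⟨Q, hQmax, hQl⟩ := Ideal.exists_maximal_ideal_liesOver_of_isIntegral (S := 𝓞 L) 𝔩
  have hQprime : Q.IsPrime := hQmax.isPrime
  obtain ⟨F, _, _, π, hπ⟩ : ∃ (F : Type) (_ : CommRing F) (_ : IsDomain F) (π : 𝓞 L →+* F),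
      ∀ t, π t = 0 ↔ t ∈ Q :=
    ⟨𝓞 L ⧸ Q, inferInstance, inferInstance, Ideal.Quotient.mk Q,
      fun _ ↦ Ideal.Quotient.eq_zero_iff_mem⟩
  have hℓQ : (ℓ : 𝓞 L) ∈ Q := by
    have h : (ℓ : ℤ) ∈ Q.under ℤ := by
      rw [← hQl.over]
      exact Ideal.mem_span_singleton_self _
    simpa [Ideal.under] using h
  have hℓF : (ℓ : F) = 0 := by simpa using (hπ _).2 hℓQ
  have hc : ((P.eval a : ℤ) : F) = 0 := by
    rw [hPa]
    push_cast
    rw [hℓF, zero_pow hr.pos.ne', zero_mul]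
  have hPaF : aeval (a : F) P = 0 := by rw [aeval_intCast_eq, hc]
  have hW0 := hroot F hℓF hPaF
  obtain ⟨g, hg, hga⟩ := exists_eq_sq_mul_add_C_of_derivative hW
  have hgaF : aeval (a : F) g ≠ 0 := by
    intro h
    refine hW0 _ hPaF ?_
    rw [aeval_intCast_eq] at h ⊢
    rw [← hga, Int.cast_mul, h, mul_zero]
  have hint (x : P.rootSet L) : IsIntegral ℤ (x : L) := ⟨P, hP, (mem_rootSet.1 x.2).2⟩
  let ρ (x : P.rootSet L) : 𝓞 L := ⟨x, hint x⟩
  have hρinj : Function.Injective ρ := fun x y h ↦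
    Subtype.ext (congrArg (algebraMap (𝓞 L) L) h)
  have hρ (x : P.rootSet L) : aeval (ρ x) P = 0 := by
    apply RingOfIntegers.coe_injective
    rw [map_zero, ← aeval_algebraMap_apply]
    exact (mem_rootSet.1 x.2).2
  have hPS : P.map (algebraMap ℤ (𝓞 L)) ≠ 0 := (hP.map _).ne_zero
  have hρroot (x : P.rootSet L) : (P.map (algebraMap ℤ (𝓞 L))).IsRoot (ρ x) := by
    rw [IsRoot.def, eval_map_algebraMap, hρ]
  have hρF (x : P.rootSet L) (f : ℤ[X]) : aeval (π (ρ x)) f = π (aeval (ρ x) f) :=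
    aeval_algHom_apply π.toIntAlgHom (ρ x) f
  have hmap : (P.map (algebraMap ℤ (𝓞 L))).map π = P.map (algebraMap ℤ (F)) := by
    rw [Polynomial.map_map]
    congr 1
    exact RingHom.ext_int _ _
  have hpair {x y : P.rootSet L} (hxy : x ≠ y) (h : π (ρ x) = π (ρ y)) :
      π (ρ x) = (a : F) := by
    have hd := multiset_prod_X_sub_C_dvd hPS (s := {ρ x, ρ y})
      (by simpa using hρinj.ne hxy) (by
        intro t ht
        simp only [Multiset.insert_eq_cons, Multiset.mem_cons, Multiset.mem_singleton] at ht
        rcases ht with rfl | rfl <;> exact hρroot _)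
    simp only [Multiset.insert_eq_cons, Multiset.map_cons, Multiset.map_singleton,
      Multiset.prod_cons, Multiset.prod_singleton] at hd
    obtain ⟨q, hq⟩ := hd
    have hq' := congrArg (Polynomial.map π) hq
    rw [hmap] at hq'
    have h0 : aeval (π (ρ x)) (derivative P) = 0 := by
      rw [← eval_map_algebraMap, ← derivative_map, hq']
      simp [← h]
    rw [hW, map_mul] at h0
    have := (mul_eq_zero.1 h0).resolve_right (hW0 _ (by rw [hρF, hρ, map_zero]))
    simpa [sub_eq_zero] using this
  have htriple {x y z : P.rootSet L} (hxy : x ≠ y) (hxz : x ≠ z) (hyz : y ≠ z)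
      (hx : π (ρ x) = (a : F)) (hy : π (ρ y) = (a : F))
      (hz : π (ρ z) = (a : F)) : False := by
    have hd := multiset_prod_X_sub_C_dvd hPS (s := {ρ x, ρ y, ρ z})
      (by simp [hρinj.eq_iff, hxy, hxz, hyz]) (by
        intro t ht
        simp only [Multiset.insert_eq_cons, Multiset.mem_cons, Multiset.mem_singleton] at ht
        rcases ht with rfl | rfl | rfl <;> exact hρroot _)
    simp only [Multiset.insert_eq_cons, Multiset.map_cons, Multiset.map_singleton,
      Multiset.prod_cons, Multiset.prod_singleton] at hd
    obtain ⟨q, hq⟩ := hd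
    have hq' := congrArg (Polynomial.map π) hq
    rw [hmap, hg] at hq'
    simp only [Polynomial.map_add, Polynomial.map_mul, Polynomial.map_pow, Polynomial.map_sub,
      map_X, map_C, hx, hy, hz, algebraMap_int_eq, Int.coe_castRingHom, hc] at hq'
    have h3 : (X - C (a : F)) ^ 2 * g.map (Int.castRingHom (F)) =
        (X - C (a : F)) ^ 2 * ((X - C (a : F)) * q.map π) := by
      rw [← add_zero (_ * _), ← C_0, hq']
      ring
    have h4 := congrArg (eval (a : F))
      (((monic_X_sub_C (a : F)).pow 2).isRegular.left h3)
    refine hgaF ?_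
    rw [← eval_map_algebraMap, algebraMap_int_eq, h4]
    simp
  obtain ⟨α, hα⟩ : ∃ α : P.rootSet L, π (ρ α) = (a : F) := by
    obtain ⟨s, hs⟩ : ∃ s : Multiset (P.rootSet L),
        Multiset.map (fun x : P.rootSet L ↦ (x : L)) s = (P.map (algebraMap ℤ L)).roots := by
      refine CanLift.prf (self := Multiset.canLift _ (· ∈ P.rootSet L)) _ fun x hx ↦ ?_
      simpa [rootSet, aroots] using hx
    have h1 : ((s.map fun x ↦ (a : 𝓞 L) - ρ x).prod : 𝓞 L) = ((P.eval a : ℤ) : 𝓞 L) := by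
      apply RingOfIntegers.coe_injective
      have h2 := congrArg (eval (a : L)) hsplit.eq_prod_roots
      rw [eval_map_algebraMap, aeval_intCast_eq, (hP.map _).leadingCoeff, C_1, one_mul, ← hs,
        eval_multiset_prod] at h2
      rw [map_multiset_prod, map_intCast, h2]
      simp only [Multiset.map_map, Function.comp_def, map_sub, map_intCast, eval_sub, eval_X,
        eval_C]
      rfl
    have h2 : (s.map fun x ↦ (a : 𝓞 L) - ρ x).prod ∈ Q := by
      rw [h1, hPa]
      push_cast
      exact Q.mul_mem_right _ (Q.pow_mem_of_mem hℓQ _ hr.pos)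
    obtain ⟨t, ht, htQ⟩ := (hQprime.multiset_prod_mem_iff_exists_mem _).1 h2
    obtain ⟨α, -, rfl⟩ := Multiset.mem_map.1 ht
    refine ⟨α, ?_⟩
    have := (hπ _).2 htQ
    rw [map_sub, map_intCast, sub_eq_zero] at this
    exact this.symm
  have hinertia : Nat.card (Q.inertia Gal(L/ℚ)) ≠ 1 := by
    intro h1
    rw [Ideal.card_inertia_eq_ramificationIdxIn 𝔩 Q,
      Ideal.ramificationIdxIn_eq_ramificationIdx 𝔩 Q Gal(L/ℚ),
      Ideal.IsDedekindDomain.ramificationIdx_eq_multiplicity 𝔩 Q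
        (Ideal.map_ne_bot_of_ne_bot h𝔩0), Ideal.map_span, Set.image_singleton] at h1
    have hQ0 : Q ≠ ⊥ := Ideal.ne_bot_of_liesOver_of_ne_bot h𝔩0 Q
    have hQp : Prime Q := Ideal.prime_of_isPrime hQ0 hQprime
    have hndvd {t : 𝓞 L} (ht : t ∉ Q) : emultiplicity Q (Ideal.span {t}) = 0 := by
      rw [emultiplicity_eq_zero, Ideal.dvd_span_singleton]
      exact ht
    have huQ : (u : 𝓞 L) ∉ Q := by
      intro huQ
      obtain ⟨m, n, hmn⟩ := (hℓZ.coprime_iff_not_dvd).2 hu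
      refine hQprime.ne_top ((Ideal.eq_top_iff_one _).2 ?_)
      have := congrArg (Int.cast : ℤ → 𝓞 L) hmn
      push_cast at this
      rw [← this]
      exact Q.add_mem (Q.mul_mem_left _ hℓQ) (Q.mul_mem_left _ huQ)
    have hgQ : aeval (ρ α) g ∉ Q := by
      rw [← hπ, ← hρF, hα]
      exact hgaF
    have heq : (ρ α - a) ^ 2 * aeval (ρ α) g = (ℓ : 𝓞 L) ^ r * ((u : 𝓞 L) * (-1)) := by
      have h2 := hρ α
      rw [hg] at h2
      have h3 : ((P.eval a : ℤ) : 𝓞 L) = (ℓ : 𝓞 L) ^ r * u := by rw [hPa]; push_cast; rfl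
      simp only [map_add, map_mul, map_pow, map_sub, aeval_X, aeval_C, algebraMap_int_eq,
        Int.coe_castRingHom, h3] at h2
      linear_combination h2
    obtain ⟨v, hv, hvQ⟩ : ∃ v : 𝓞 L, (u : 𝓞 L) * (-1) = v ∧ v ∉ Q :=
      ⟨_, rfl, by simpa using huQ⟩
    rw [hv] at heq
    have hid := congrArg (fun t : 𝓞 L ↦ emultiplicity Q (Ideal.span {t})) heq
    simp only [← Ideal.span_singleton_mul_span_singleton, ← Ideal.span_singleton_pow,
      emultiplicity_mul hQp, emultiplicity_pow hQp, hndvd hgQ, hndvd hvQ, add_zero] at hid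
    have hℓfin : FiniteMultiplicity Q (Ideal.span {(ℓ : 𝓞 L)}) :=
      FiniteMultiplicity.of_prime_left hQp (by simpa using hℓ.ne_zero)
    have hαfin : FiniteMultiplicity Q (Ideal.span {ρ α - (a : 𝓞 L)}) := by
      refine FiniteMultiplicity.of_prime_left hQp ?_
      intro h0
      have h0' : ρ α - (a : 𝓞 L) = 0 := by simpa using h0
      rw [h0', zero_pow two_ne_zero, zero_mul] at heq
      refine mul_ne_zero (pow_ne_zero _ ?_) ?_ heq.symm
      · exact_mod_cast hℓ.ne_zero
      · rintro rfl
        exact hvQ Q.zero_mem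
    rw [hℓfin.emultiplicity_eq_multiplicity, hαfin.emultiplicity_eq_multiplicity] at hid
    simp only [algebraMap_int_eq, eq_intCast, Int.cast_natCast] at h1
    rw [h1] at hid
    norm_cast at hid
    obtain ⟨k, rfl⟩ := hr
    omega
  have : Nontrivial (Q.inertia Gal(L/ℚ)) := by
    by_contra h
    rw [not_nontrivial_iff_subsingleton] at h
    exact hinertia Nat.card_unique
  obtain ⟨⟨σ, hσI⟩, hσ1⟩ := exists_ne (1 : Q.inertia Gal(L/ℚ))
  have hσ1 : σ ≠ 1 := fun h ↦ hσ1 (Subtype.ext h)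
  have hρσ (x : P.rootSet L) : π (ρ (σ • x)) = π (ρ x) := by
    rw [← sub_eq_zero, ← map_sub, hπ]
    have h1 : ρ (σ • x) = σ • ρ x := by
      apply RingOfIntegers.coe_injective
      rw [algebraMap.smul']
      rfl
    rw [h1]
    exact hσI (ρ x)
  obtain ⟨x, hx⟩ : ∃ x : P.rootSet L, σ • x ≠ x := by
    by_contra! h
    exact hσ1 (FaithfulSMul.eq_of_smul_eq_smul (α := P.rootSet L) fun x ↦ by simpa using h x)
  have hmoved {z : P.rootSet L} (hz : σ • z ≠ z) : π (ρ z) = (a : F) :=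
    hpair hz.symm (hρσ z).symm
  refine ⟨σ, x, σ • x, hx.symm, fun z ↦ ?_⟩
  have hxa := hmoved hx
  have hσxa := (hρσ x).trans hxa
  rcases eq_or_ne z x with rfl | hzx
  · simp
  rcases eq_or_ne z (σ • x) with rfl | hzy
  · rw [Equiv.swap_apply_right]
    by_contra h
    exact htriple hx.symm (Ne.symm h) (fun h' ↦ hx ((smul_left_cancel σ h').symm)) hxa hσxa
      ((hρσ _).trans hσxa)
  · rw [Equiv.swap_apply_of_ne_of_ne hzx hzy]
    by_contra h
    exact htriple hx.symm hzx.symm hzy.symm hxa hσxa (hmoved h)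

end Inertia

section Iterate

theorem polyIter_add {R : Type*} [CommRing R] (φ : R[X]) (m n : ℕ) :
    polyIter φ (m + n) = (polyIter φ m).comp (polyIter φ n) := by
  induction m with
  | zero => simp [polyIter]
  | succ m ih => rw [Nat.succ_add, polyIter, polyIter, ih, comp_assoc]

theorem aeval_polyIter_add {R A : Type*} [CommRing R] [CommRing A] [Algebra R A] (φ : R[X])
    (m n : ℕ) (x : A) :
    aeval x (polyIter φ (m + n)) = aeval (aeval x (polyIter φ n)) (polyIter φ m) := by
  rw [polyIter_add, aeval_comp]

theorem aeval_polyIter_succ {R A : Type*} [CommRing R] [CommRing A] [Algebra R A] (φ : R[X])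
    (n : ℕ) (x : A) : aeval x (polyIter φ (n + 1)) = aeval (aeval x (polyIter φ n)) φ := by
  rw [polyIter, aeval_comp]

theorem polyIter_succ_eq_comp {R : Type*} [CommRing R] (φ : R[X]) (n : ℕ) :
    polyIter φ (n + 1) = (polyIter φ n).comp φ := by
  rw [polyIter_add]
  simp [polyIter]

theorem natDegree_polyIter {R : Type*} [CommRing R] [IsDomain R] (φ : R[X]) (n : ℕ) :
    (polyIter φ n).natDegree = φ.natDegree ^ n := by
  induction n with
  | zero => simp [polyIter]
  | succ n ih => rw [polyIter, natDegree_comp, ih, pow_succ']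

theorem monic_polyIter {R : Type*} [CommRing R] [IsDomain R] {φ : R[X]} (hφ : φ.Monic)
    (h : φ.natDegree ≠ 0) (n : ℕ) : (polyIter φ n).Monic := by
  induction n with
  | zero => exact monic_X
  | succ n ih =>
    refine hφ.comp ih ?_
    rw [natDegree_polyIter]
    exact pow_ne_zero _ h

theorem derivative_polyIter_succ {R : Type*} [CommRing R] {φ c w : R[X]}
    (h : derivative φ = c * w) (n : ℕ) :
    derivative (polyIter φ (n + 1)) =
      c * (w * ∏ j ∈ Finset.range n, (derivative φ).comp (polyIter φ (j + 1))) := by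
  induction n with
  | zero => simp [polyIter, h]
  | succ n ih =>
    rw [polyIter, derivative_comp, ih, Finset.prod_range_succ]
    ring

end Iterate

section Family

variable {p k : ℕ} {φ : ℤ[X]}

theorem aeval_family (hp : p ≠ 0)
    (hφ : φ = X ^ p + C ((k : ℤ) * p) * X ^ (p - 1) - C ((k : ℤ) * p))
    {A : Type*} [CommRing A] (x : A) :
    aeval x φ = x ^ (p - 1) * (x + k * p) - k * p := by
  obtain ⟨q, rfl⟩ := Nat.exists_eq_succ_of_ne_zero hp
  simp [hφ]
  ring

theorem natDegree_family (hp : p ≠ 0)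
    (hφ : φ = X ^ p + C ((k : ℤ) * p) * X ^ (p - 1) - C ((k : ℤ) * p)) :
    φ.natDegree = p ∧ φ.Monic := by
  obtain ⟨q, rfl⟩ := Nat.exists_eq_succ_of_ne_zero hp
  rw [add_sub_assoc] at hφ
  have h : (C ((k : ℤ) * (q + 1 : ℕ)) * X ^ q - C ((k : ℤ) * (q + 1 : ℕ))).natDegree <
      (X ^ (q + 1) : ℤ[X]).natDegree := by
    rw [natDegree_X_pow, Nat.lt_succ_iff]
    compute_degree
  rw [hφ]
  exact ⟨(natDegree_add_eq_left_of_natDegree_lt h).trans (natDegree_X_pow _),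
    (monic_X_pow _).add_of_left (degree_lt_degree h)⟩

theorem derivative_family (hp : 2 ≤ p)
    (hφ : φ = X ^ p + C ((k : ℤ) * p) * X ^ (p - 1) - C ((k : ℤ) * p)) :
    derivative φ = (X - C (-(k : ℤ) * ((p : ℤ) - 1))) * (C (p : ℤ) * X ^ (p - 2)) := by
  obtain ⟨q, rfl⟩ := Nat.exists_eq_add_of_le' hp
  simp [hφ]
  ring

theorem polyIter_aeval_zero (hp : 2 ≤ p)
    (hφ : φ = X ^ p + C ((k : ℤ) * p) * X ^ (p - 1) - C ((k : ℤ) * p))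
    {A : Type*} [CommRing A] (n : ℕ) :
    aeval (0 : A) (polyIter φ (n + 1)) = -(k * p) := by
  induction n with
  | zero =>
    rw [aeval_polyIter_succ, aeval_family (by omega) hφ]
    simp [polyIter, show p - 1 ≠ 0 by omega]
  | succ n ih =>
    rw [aeval_polyIter_succ, ih, aeval_family (by omega) hφ]
    simp

/-- In a domain in which `a` is a root of an iterate of `φ`, the cofactor of `X - C a` in the
derivative of that iterate does not vanish at the roots of the iterate. -/
theorem aeval_cofactor_ne_zero (hp : 2 ≤ p)
    (hφ : φ = X ^ p + C ((k : ℤ) * p) * X ^ (p - 1) - C ((k : ℤ) * p))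
    {F : Type*} [CommRing F] [IsDomain F] (hkp : (k * p : F) ≠ 0) {a : ℤ}
    {w : ℤ[X]} (hw : derivative φ = (X - C a) * w) (hw0 : ∀ x : F, x ≠ 0 → aeval x w ≠ 0) {n : ℕ}
    (ha : aeval (a : F) (polyIter φ (n + 1)) = 0) {x : F}
    (hx : aeval x (polyIter φ (n + 1)) = 0) :
    aeval x (w * ∏ j ∈ Finset.range n, (derivative φ).comp (polyIter φ (j + 1))) ≠ 0 := by
  have h0 {j : ℕ} (hj : j ≤ n) : aeval x (polyIter φ j) ≠ 0 := by
    intro h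
    rw [show n + 1 = (n - j + 1) + j by omega, aeval_polyIter_add, h,
      polyIter_aeval_zero hp hφ] at hx
    exact hkp (neg_eq_zero.1 hx)
  have h1 {j : ℕ} (hj : j < n) : aeval x (polyIter φ (j + 1)) ≠ (a : F) := by
    intro h
    rw [show n + 1 = (n - j) + (j + 1) by omega, aeval_polyIter_add, h] at hx
    rw [show n + 1 = (j + 1) + (n - j) by omega, aeval_polyIter_add, hx,
      polyIter_aeval_zero hp hφ] at ha
    exact hkp (neg_eq_zero.1 ha)
  rw [map_mul, map_prod]
  refine mul_ne_zero (hw0 _ (h0 (j := 0) (by omega) ∘ fun h ↦ by simpa [polyIter] using h))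
    (Finset.prod_ne_zero_iff.2 fun j hj ↦ ?_)
  have hj' := Finset.mem_range.1 hj
  rw [aeval_comp, hw, map_mul]
  exact mul_ne_zero (by simpa [sub_eq_zero] using h1 hj') (hw0 _ (h0 hj'))

theorem exists_eval_polyIter_eq_mul (hp : p.Prime) (hp3 : 3 ≤ p) (hk : 0 < k) (hpk : ¬ p ∣ k)
    (hφ : φ = X ^ p + C ((k : ℤ) * p) * X ^ (p - 1) - C ((k : ℤ) * p)) (n : ℕ) :
    ∃ m : ℤ, (polyIter φ (n + 1)).eval (-(k : ℤ) * ((p : ℤ) - 1)) = k * m ∧ 0 < m ∧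
      IsCoprime m (k * p) := by
  have hkp : IsCoprime (k : ℤ) p :=
    Nat.isCoprime_iff_coprime.2 ((hp.coprime_iff_not_dvd.2 hpk).symm)
  have hstep (t : ℤ) : φ.eval (k * t) = k * ((k * t) ^ (p - 1) * (t + p) - p) := by
    have := aeval_family hp.ne_zero hφ ((k : ℤ) * t)
    simp only [coe_aeval_eq_eval] at this
    rw [this]
    ring
  have hcop {t : ℤ} (ht : IsCoprime t p) :
      IsCoprime ((k * t) ^ (p - 1) * (t + p) - p) ((k : ℤ) * p) := by
    refine IsCoprime.mul_right ?_ ?_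
    · have h : ((k : ℤ) * t) ^ (p - 1) * (t + p) - p =
          -p + k * (t * (k * t) ^ (p - 2) * (t + p)) := by
        rw [show p - 1 = (p - 2) + 1 by omega, pow_succ]
        ring
      rw [h]
      exact hkp.symm.neg_left.add_mul_left_left _
    · have h : ((k : ℤ) * t) ^ (p - 1) * (t + p) - p =
          (k * t) ^ (p - 1) * t + p * ((k * t) ^ (p - 1) - 1) := by ring
      rw [h]
      exact (((hkp.mul_left ht).pow_left).mul_left ht).add_mul_left_left _
  induction n with
  | zero =>
    refine ⟨_, by rw [polyIter, polyIter, comp_X, ← hstep, neg_mul, mul_neg], ?_, hcop ?_⟩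
    · rw [mul_neg, (hp.even_sub_one (by omega)).neg_pow]
      have h1 : ((p : ℤ) - 1) ^ 2 ≤ ((k : ℤ) * (p - 1)) ^ (p - 1) := by
        have hp3' : (3 : ℤ) ≤ p := by exact_mod_cast hp3
        have hk' : (1 : ℤ) ≤ k := by exact_mod_cast hk
        calc ((p : ℤ) - 1) ^ 2 ≤ ((p : ℤ) - 1) ^ (p - 1) :=
              pow_le_pow_right₀ (by omega) (by omega)
          _ ≤ _ := pow_le_pow_left₀ (by omega) (by nlinarith) _
      have hp3' : (3 : ℤ) ≤ p := by exact_mod_cast hp3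
      nlinarith
    · exact ⟨1, 1, by ring⟩
  | succ n ih =>
    obtain ⟨t, ht, ht0, htc⟩ := ih
    refine ⟨_, by rw [polyIter, eval_comp, ht, hstep], ?_, hcop htc.of_mul_right_right⟩
    have hk' : (0 : ℤ) < k := by exact_mod_cast hk
    have : 0 < ((k : ℤ) * t) ^ (p - 1) := by positivity
    nlinarith

theorem map_polyIter_family_zmod
    (hφ : φ = X ^ p + C ((k : ℤ) * p) * X ^ (p - 1) - C ((k : ℤ) * p)) (n : ℕ) :
    (polyIter φ n).map (Int.castRingHom (ZMod p)) = X ^ p ^ n := by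
  induction n with
  | zero => simp [polyIter]
  | succ n ih =>
    rw [polyIter, Polynomial.map_comp, ih]
    simp [hφ, pow_succ, pow_mul]

theorem irreducible_polyIter_family (hp : p.Prime) (hpk : ¬ p ∣ k)
    (hφ : φ = X ^ p + C ((k : ℤ) * p) * X ^ (p - 1) - C ((k : ℤ) * p)) (n : ℕ) :
    Irreducible ((polyIter φ (n + 1)).map (algebraMap ℤ ℚ)) := by
  obtain ⟨hd, hm⟩ := natDegree_family hp.ne_zero hφ
  have hM := monic_polyIter hm (by rw [hd]; exact hp.ne_zero) (n + 1)
  have hD : (polyIter φ (n + 1)).natDegree = p ^ (n + 1) := by rw [natDegree_polyIter, hd]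
  rw [← hM.irreducible_iff_irreducible_map_fraction_map]
  have hpZ : Prime (p : ℤ) := Nat.prime_iff_prime_int.1 hp
  have hpI : (Ideal.span {(p : ℤ)}).IsPrime := (Ideal.span_singleton_prime hpZ.ne_zero).2 hpZ
  refine IsEisensteinAt.irreducible (𝓟 := Ideal.span {(p : ℤ)}) ⟨?_, ?_, ?_⟩ hpI hM.isPrimitive ?_
  · rw [hM.leadingCoeff]
    exact fun h ↦ hpI.ne_top ((Ideal.eq_top_iff_one _).2 h)
  · intro i hi
    rw [hD] at hi
    have := congrArg (fun f ↦ coeff f i) (map_polyIter_family_zmod hφ (n + 1))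
    simp only [coeff_map, coeff_X_pow, hi.ne, if_false, eq_intCast] at this
    rw [Ideal.mem_span_singleton]
    exact (ZMod.intCast_zmod_eq_zero_iff_dvd _ _).1 this
  · have h0 := polyIter_aeval_zero hp.two_le hφ (A := ℤ) n
    rw [coe_aeval_eq_eval, ← coeff_zero_eq_eval_zero] at h0
    rw [h0, Ideal.span_singleton_pow, Ideal.mem_span_singleton, dvd_neg, pow_two,
      mul_dvd_mul_iff_right hpZ.ne_zero]
    exact_mod_cast hpk
  · rw [hD]
    exact pow_pos hp.pos _

theorem Nat.exists_prime_pow_odd_mul_of_not_isSquare {m : ℕ} (hm : 0 < m)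
    (h : ¬ IsSquare m) :
    ∃ ℓ r u : ℕ, ℓ.Prime ∧ Odd r ∧ ¬ ℓ ∣ u ∧ m = ℓ ^ r * u := by
  obtain ⟨c, b, -, hb, rfl, hc⟩ := Nat.sq_mul_squarefree_of_pos hm
  obtain ⟨ℓ, hℓ, d, rfl⟩ := Nat.exists_prime_and_dvd (n := c) (by
    rintro rfl
    exact h ⟨b, by ring⟩)
  obtain ⟨e, b, hb', rfl⟩ := Nat.exists_eq_pow_mul_and_not_dvd hb.ne' ℓ hℓ.ne_one
  refine ⟨ℓ, 2 * e + 1, b ^ 2 * d, hℓ, ⟨e, rfl⟩, ?_, by ring⟩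
  rw [hℓ.dvd_mul, not_or]
  refine ⟨fun h' ↦ hb' (hℓ.dvd_of_dvd_pow h'), fun h' ↦ hℓ.not_isUnit (hc ℓ ?_)⟩
  exact mul_dvd_mul_left ℓ h'

end Family

section Galois

open IntermediateField

theorem mem_rootSet_iff_eval₂_eq_zero {P : ℤ[X]} (hP : P.Monic) {A : Type*} [Field A]
    [CharZero A] [Algebra ℤ A] {x : A} : x ∈ P.rootSet A ↔ eval₂ (Int.castRingHom A) x P = 0 := by
  rw [mem_rootSet_of_injective (RingHom.injective_int _) hP.ne_zero, aeval_def,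
    Subsingleton.elim (algebraMap ℤ A) (Int.castRingHom A)]

theorem rootSet_map_algebraMap (P : ℤ[X]) (A : Type*) [Field A] [Algebra ℚ A] [Algebra ℤ A] :
    (P.map (algebraMap ℤ ℚ)).rootSet A = P.rootSet A := by
  rw [rootSet, rootSet, aroots, aroots, Polynomial.map_map,
    Subsingleton.elim (RingHom.comp _ _) (algebraMap ℤ A)]

theorem card_fiber_eq_natDegree {φ Q : ℤ[X]} (hφ : φ.Monic) (hd : 0 < φ.natDegree)
    (hQ : Q.Monic) {L : Type*} [Field L] [CharZero L]
    (hsplit : ((Q.comp φ).map (algebraMap ℤ L)).Splits)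
    (hsep : ((Q.comp φ).map (algebraMap ℤ L)).Separable) {f : (Q.comp φ).rootSet L → Q.rootSet L}
    (hf : ∀ x, (f x : L) = aeval (x : L) φ) (y : Q.rootSet L) :
    Nat.card {x // f x = y} = φ.natDegree := by
  classical
  have hQφ : (Q.comp φ).Monic := hQ.comp hφ hd.ne'
  have hdeg : (C (y : L)).degree < (φ.map (algebraMap ℤ L)).degree := by
    refine degree_C_le.trans_lt ?_
    rw [hφ.degree_map]
    exact natDegree_pos_iff_degree_pos.1 hd
  have hdvd : φ.map (algebraMap ℤ L) - C (y : L) ∣ (Q.comp φ).map (algebraMap ℤ L) := by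
    have hy : X - C (y : L) ∣ Q.map (algebraMap ℤ L) := by
      rw [dvd_iff_isRoot, IsRoot.def, eval_map_algebraMap]
      exact (mem_rootSet.1 y.2).2
    obtain ⟨s, hs⟩ := hy
    rw [Polynomial.map_comp, hs]
    simp
  have hcard := card_rootSet_eq_natDegree (K := L) (hsep.of_dvd hdvd)
    (by simpa using hsplit.of_dvd (hQφ.map _).ne_zero hdvd)
  rw [natDegree_sub_C, hφ.natDegree_map, ← Nat.card_eq_fintype_card] at hcard
  rw [← hcard]
  have hne : φ.map (algebraMap ℤ L) - C (y : L) ≠ 0 := by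
    intro h
    rw [sub_eq_zero] at h
    exact hdeg.ne' (congrArg degree h)
  have hmem (z : L) : z ∈ (φ.map (algebraMap ℤ L) - C (y : L)).rootSet L ↔ aeval z φ = y := by
    rw [mem_rootSet_of_ne hne]
    simp [sub_eq_zero, eval_map, aeval_def]
  exact Nat.card_congr
    { toFun x := ⟨x.1, (hmem _).2 (by rw [← hf, x.2])⟩
      invFun z := ⟨⟨z, mem_rootSet.2 ⟨hQφ.ne_zero, by
        rw [aeval_comp, (hmem _).1 z.2]
        exact (mem_rootSet.1 y.2).2⟩⟩, Subtype.ext (by rw [hf]; exact (hmem _).1 z.2)⟩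
      left_inv _ := rfl
      right_inv _ := rfl }

theorem faithfulSMul_rootSet {P : ℤ[X]} {L : Type*} [Field L] [Algebra ℚ L]
    (h : Algebra.adjoin ℚ (P.rootSet L) = ⊤) : FaithfulSMul Gal(L/ℚ) (P.rootSet L) where
  eq_of_smul_eq_smul {σ τ} hστ := by
    have : (σ : L →ₐ[ℚ] L) = τ := AlgHom.ext_of_adjoin_eq_top h fun x hx ↦
      congrArg Subtype.val (hστ ⟨x, hx⟩)
    ext x
    exact DFunLike.congr_fun this x

theorem isPretransitive_rootSet {P : ℤ[X]} (hP : P.Monic)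
    (hirr : Irreducible (P.map (algebraMap ℤ ℚ))) {L : Type*} [Field L] [CharZero L]
    [Normal ℚ L] : MulAction.IsPretransitive Gal(L/ℚ) (P.rootSet L) where
  exists_smul_eq x y := by
    have hmin (z : P.rootSet L) : P.map (algebraMap ℤ ℚ) = minpoly ℚ (z : L) :=
      minpoly.eq_of_irreducible_of_monic hirr
        (by rw [aeval_map_algebraMap]; exact (mem_rootSet.1 z.2).2) (hP.map _)
    obtain ⟨σ, hσ⟩ := isConjRoot_iff_exists_algEquiv.1
      (show IsConjRoot ℚ (y : L) (x : L) from (hmin y).symm.trans (hmin x))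
    exact ⟨σ, Subtype.ext hσ⟩

theorem mem_Kfield_succ_of_mem_rootSet {φ : ℤ[X]} (hφ : φ.Monic) (hd : 0 < φ.natDegree) {n : ℕ}
    {y : AlgebraicClosure ℚ} (hy : y ∈ (polyIter φ n).rootSet (AlgebraicClosure ℚ)) :
    y ∈ Kfield φ (n + 1) := by
  obtain ⟨x, hx⟩ := IsAlgClosed.exists_root
      (φ.map (Int.castRingHom (AlgebraicClosure ℚ)) - C y) (by
    rw [degree_sub_C] <;> rw [hφ.degree_map]
    · exact (natDegree_pos_iff_degree_pos.1 hd).ne'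
    · exact natDegree_pos_iff_degree_pos.1 hd)
  have hxy : eval₂ (Int.castRingHom _) x φ = y := by simpa [sub_eq_zero, eval_map] using hx
  have hxK : x ∈ Kfield φ (n + 1) := by
    refine subset_adjoin _ _ ?_
    rw [mem_rootSet_iff_eval₂_eq_zero (monic_polyIter hφ hd.ne' _), polyIter_succ_eq_comp,
      eval₂_comp, hxy]
    exact (mem_rootSet_iff_eval₂_eq_zero (monic_polyIter hφ hd.ne' _)).1 hy
  have := (eval₂ (Int.castRingHom _) (⟨x, hxK⟩ : Kfield φ (n + 1)) φ).2
  rwa [← IntermediateField.algebraMap_apply, hom_eval₂, Subsingleton.elim (RingHom.comp _ _)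
    (Int.castRingHom _), IntermediateField.algebraMap_apply, hxy] at this

theorem relGalCard_succ_eq_card_fixing {φ : ℤ[X]} (hφ : φ.Monic) (hd : 0 < φ.natDegree) (n : ℕ) :
    relGalCard φ (n + 1) = Nat.card {σ : Gal(Kfield φ (n + 1)/ℚ) //
      ∀ y, eval₂ (Int.castRingHom _) y (polyIter φ n) = 0 → σ y = y} := by
  have hQ := monic_polyIter hφ hd.ne' n
  have hcoe (y : Kfield φ (n + 1)) :
      (y : AlgebraicClosure ℚ) ∈ (polyIter φ n).rootSet (AlgebraicClosure ℚ) ↔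
        eval₂ (Int.castRingHom _) y (polyIter φ n) = 0 := by
    rw [mem_rootSet_iff_eval₂_eq_zero hQ, ← IntermediateField.algebraMap_apply,
      ← Subsingleton.elim ((algebraMap (Kfield φ (n + 1)) (AlgebraicClosure ℚ)).comp
        (Int.castRingHom _)) (Int.castRingHom _), ← hom_eval₂, map_eq_zero]
  refine Nat.card_congr (Equiv.subtypeEquivRight fun σ ↦ ⟨fun h y hy ↦ ?_, fun h x hx hx' ↦ ?_⟩)
  · exact h y (subset_adjoin _ _ ((hcoe y).2 hy)) y.2
  · rw [Nat.add_sub_cancel] at hx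
    suffices ∃ hx' : x ∈ Kfield φ (n + 1), σ ⟨x, hx'⟩ = ⟨x, hx'⟩ from this.2
    clear hx'
    induction hx using adjoin_induction with
    | mem y hy =>
      have hyK := mem_Kfield_succ_of_mem_rootSet hφ hd hy
      exact ⟨hyK, h ⟨y, hyK⟩ ((hcoe ⟨y, hyK⟩).1 hy)⟩
    | algebraMap q => exact ⟨(Kfield φ (n + 1)).algebraMap_mem q, σ.commutes q⟩
    | add x y _ _ hx hy =>
      obtain ⟨hx, hσx⟩ := hx
      obtain ⟨hy, hσy⟩ := hy
      exact ⟨add_mem hx hy, (map_add σ ⟨x, hx⟩ ⟨y, hy⟩).trans (congrArg₂ (· + ·) hσx hσy)⟩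
    | inv x _ hx =>
      obtain ⟨hx, hσx⟩ := hx
      exact ⟨inv_mem hx, (map_inv₀ σ ⟨x, hx⟩).trans (congrArg (·⁻¹) hσx)⟩
    | mul x y _ _ hx hy =>
      obtain ⟨hx, hσx⟩ := hx
      obtain ⟨hy, hσy⟩ := hy
      exact ⟨mul_mem hx hy, (map_mul σ ⟨x, hx⟩ ⟨y, hy⟩).trans (congrArg₂ (· * ·) hσx hσy)⟩

/-- If `φ` has prime degree at least `3`, `Q.comp φ` is irreducible with splitting field `L`, and
the value of `Q.comp φ` at a critical point has odd valuation at a suitable prime, then the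
automorphisms of `L` fixing the roots of `Q` permute the roots of each fibre of `φ` arbitrarily. -/
theorem card_fixing_roots_eq_of_critical {φ Q : ℤ[X]} (hφ : φ.Monic) (hp : φ.natDegree.Prime)
    (hp3 : 3 ≤ φ.natDegree) (hQ : Q.Monic) {n : ℕ} (hQn : Q.natDegree = φ.natDegree ^ n)
    (hirr : Irreducible ((Q.comp φ).map (algebraMap ℤ ℚ))) {a : ℤ} {W : ℤ[X]}
    (hW : derivative (Q.comp φ) = (X - C a) * W) {ℓ r : ℕ} (hℓ : ℓ.Prime) (hr : Odd r)
    {u : ℤ} (hu : ¬ (ℓ : ℤ) ∣ u) (hPa : (Q.comp φ).eval a = (ℓ : ℤ) ^ r * u)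
    (hroot : ∀ (F : Type) [CommRing F] [IsDomain F], (ℓ : F) = 0 →
      aeval (a : F) (Q.comp φ) = 0 → ∀ x : F, aeval x (Q.comp φ) = 0 → aeval x W ≠ 0)
    (L : Type) [Field L] [CharZero L]
    [IsSplittingField ℚ L ((Q.comp φ).map (algebraMap ℤ ℚ))] :
    Nat.card {σ : Gal(L/ℚ) // ∀ y, eval₂ (Int.castRingHom L) y Q = 0 → σ y = y} =
      φ.natDegree.factorial ^ φ.natDegree ^ n := by
  classical
  have hd := hp.pos
  have hP : (Q.comp φ).Monic := hQ.comp hφ hd.ne'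
  have hfin := IsSplittingField.finiteDimensional L ((Q.comp φ).map (algebraMap ℤ ℚ))
  have : NumberField L := ⟨⟩
  have : Normal ℚ L := Normal.of_isSplittingField ((Q.comp φ).map (algebraMap ℤ ℚ))
  have : IsGalois ℚ L := ⟨⟩
  have hsplit : ((Q.comp φ).map (algebraMap ℤ L)).Splits := by
    have := IsSplittingField.splits L ((Q.comp φ).map (algebraMap ℤ ℚ))
    rwa [Polynomial.map_map, ← IsScalarTower.algebraMap_eq] at this
  have hsep : ((Q.comp φ).map (algebraMap ℤ L)).Separable := by
    have := hirr.separable.map (f := algebraMap ℚ L)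
    rwa [Polynomial.map_map, ← IsScalarTower.algebraMap_eq] at this
  have hfaith : FaithfulSMul Gal(L/ℚ) ((Q.comp φ).rootSet L) := faithfulSMul_rootSet (by
    rw [← rootSet_map_algebraMap]
    exact IsSplittingField.adjoin_rootSet L _)
  have htrans := isPretransitive_rootSet hP hirr (L := L)
  have hcard : Nat.card ((Q.comp φ).rootSet L) = φ.natDegree ^ (n + 1) := by
    have := card_rootSet_eq_natDegree (K := L) hirr.separable
      (IsSplittingField.splits L ((Q.comp φ).map (algebraMap ℤ ℚ)))
    rw [← Nat.card_eq_fintype_card, rootSet_map_algebraMap, hP.natDegree_map, natDegree_comp,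
      hQn] at this
    rw [this, pow_succ]
  let f (x : (Q.comp φ).rootSet L) : Q.rootSet L :=
    ⟨aeval (x : L) φ, mem_rootSet.2 ⟨hQ.ne_zero, by
      rw [← aeval_comp]
      exact (mem_rootSet.1 x.2).2⟩⟩
  have hf (σ : Gal(L/ℚ)) (x : (Q.comp φ).rootSet L) : f (σ • x) = σ • f x :=
    Subtype.ext (aeval_algHom_apply (σ : L →+* L).toIntAlgHom (x : L) φ)
  have hfib := card_fiber_eq_natDegree hφ hd hQ hsplit hsep (f := f) fun _ ↦ rfl
  have hY : Nat.card (Q.rootSet L) = φ.natDegree ^ n := by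
    have h := Nat.card_congr (Equiv.sigmaFiberEquiv f)
    rw [Nat.card_sigma, hcard, Finset.sum_congr rfl fun y _ ↦ hfib y, Finset.sum_const,
      Finset.card_univ, smul_eq_mul, ← Nat.card_eq_fintype_card, pow_succ] at h
    exact Nat.eq_of_mul_eq_mul_right hd h
  obtain ⟨σ, x, y, hxy, hσ⟩ := exists_smul_eq_swap hP hsplit hW hℓ hr hu hPa hroot
  rw [← hY, ← card_fixing_eq_factorial_pow hf hp hp3 hfib hcard hxy hσ]
  refine Nat.card_congr (Equiv.subtypeEquivRight fun σ ↦
    ⟨fun h y ↦ Subtype.ext (h y ((mem_rootSet_iff_eval₂_eq_zero hQ).1 y.2)), fun h y hy ↦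
      congrArg Subtype.val (h ⟨y, (mem_rootSet_iff_eval₂_eq_zero hQ).2 hy⟩)⟩)

end Galois

/-- Let `p ≥ 3` be prime, `k` a positive integer with `p ∤ k`,
`φ(x) = x^p + kp·x^{p-1} - kp`, and `a = -k(p-1)`. Fix `n ≥ 1`. If `φ^n(a) ≠ k·y²` for
every `y ∈ ℤ`, then `Gal(K_n/K_{n-1})` is maximal, i.e. has order `(p!)^(p^(n-1))`. -/
theorem stmt_11 (p k : ℕ) (hp : p.Prime) (hp3 : 3 ≤ p) (hk : 0 < k) (hpk : ¬ p ∣ k)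
    (φ : Polynomial ℤ)
    (hφ : φ = X ^ p + C ((k : ℤ) * p) * X ^ (p - 1) - C ((k : ℤ) * p))
    (a : ℤ) (ha : a = -(k : ℤ) * ((p : ℤ) - 1))
    (n : ℕ) (hn : 1 ≤ n)
    (hsq : ∀ y : ℤ, (polyIter φ n).eval a ≠ (k : ℤ) * y ^ 2) :
    relGalCard φ n = (Nat.factorial p) ^ (p ^ (n - 1)) := by
  obtain ⟨n, rfl⟩ := Nat.exists_eq_add_of_le' hn
  obtain ⟨hd, hm⟩ := natDegree_family hp.ne_zero hφ
  have hd0 : 0 < φ.natDegree := hd ▸ hp.pos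
  obtain ⟨m, hPa, hm0, hcop⟩ := exists_eval_polyIter_eq_mul hp hp3 hk hpk hφ n
  rw [← ha] at hPa
  lift m to ℕ using hm0.le
  have hmsq : ¬ IsSquare m := by
    rintro ⟨y, rfl⟩
    refine hsq y ?_
    rw [hPa]
    push_cast
    ring
  obtain ⟨ℓ, r, u, hℓ, hr, hu, rfl⟩ :=
    Nat.exists_prime_pow_odd_mul_of_not_isSquare (by exact_mod_cast hm0) hmsq
  have hcop' : IsCoprime (ℓ : ℤ) (k * p) :=
    hcop.of_isCoprime_of_dvd_left (by
      push_cast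
      exact Dvd.dvd.mul_right (dvd_pow_self _ hr.pos.ne') _)
  have hirr := irreducible_polyIter_family hp hpk hφ n
  have hder := derivative_family hp.two_le hφ
  rw [← ha] at hder
  have hroot : ∀ (F : Type) [CommRing F] [IsDomain F], (ℓ : F) = 0 →
      aeval (a : F) (polyIter φ (n + 1)) = 0 → ∀ x : F, aeval x (polyIter φ (n + 1)) = 0 →
      aeval x (C (p : ℤ) * X ^ (p - 2) *
        ∏ j ∈ Finset.range n, (derivative φ).comp (polyIter φ (j + 1))) ≠ 0 := by
    intro F _ _ hF haF x hx
    have hkp : (k * p : F) ≠ 0 := by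
      intro h
      have h1 := hcop'.map (Int.castRingHom F)
      simp [hF, h, isCoprime_zero_left] at h1
    refine aeval_cofactor_ne_zero hp.two_le hφ hkp hder (fun z hz ↦ ?_) haF hx
    simpa using mul_ne_zero (right_ne_zero_of_mul hkp) (pow_ne_zero (p - 2) hz)
  have hW := derivative_polyIter_succ hder n
  rw [relGalCard_succ_eq_card_fixing hm hd0, Nat.add_sub_cancel]
  have : IsSplittingField ℚ (Kfield φ (n + 1))
      ((polyIter φ (n + 1)).map (algebraMap ℤ ℚ)) := by
    have h := IntermediateField.adjoin_rootSet_isSplittingField (K := ℚ) (L := AlgebraicClosure ℚ)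
      (p := (polyIter φ (n + 1)).map (algebraMap ℤ ℚ)) (IsAlgClosed.splits _)
    rwa [rootSet_map_algebraMap] at h
  have hPa' : (polyIter φ (n + 1)).eval a = (ℓ : ℤ) ^ r * (k * u) := by
    rw [hPa]
    push_cast
    ring
  have hku : ¬ (ℓ : ℤ) ∣ k * u := by
    intro h
    exact hu (Int.natCast_dvd_natCast.1 ((hcop'.of_mul_right_left).dvd_of_dvd_mul_left h))
  rw [polyIter_succ_eq_comp] at hirr hroot hW hPa'
  have : IsSplittingField ℚ (Kfield φ (n + 1))
      (((polyIter φ n).comp φ).map (algebraMap ℤ ℚ)) := by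
    rwa [polyIter_succ_eq_comp] at this
  have h := card_fixing_roots_eq_of_critical hm (hd ▸ hp) (hd ▸ hp3) (monic_polyIter hm hd0.ne' n)
    (natDegree_polyIter φ n) hirr hW hℓ hr hku hPa' hroot (Kfield φ (n + 1))
  rwa [hd] at h
end

section
/- Let F be a number field with ring of integers O_F, let d ≥ 3, and let f(x) = x^d + A·x^{d−1} + B ∈ O_F[x] be irreducible over F. Let L be the splitting field of f over F. Suppose there exists a nonzero prime ideal 𝔭 of O_F dividing the ideal (B) but not the ideal (A) such that gcd(d−1, v_𝔭(B)) = 1, where v_𝔭 is the 𝔭-adic valuation. Then Gal(L/F) contains a subgroup acting transitively on d−1 of the roots of f and fixing the remaining root; in particular, the action of Gal(L/F) on the d roots of f is doubly transitive: for any ordered pairs (x₁, x₂) and (y₁, y₂) of distinct roots of f there exists σ ∈ Gal(L/F) with σ(x₁) = y₁ and σ(x₂) = y₂. -/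
open Polynomial NumberField

section Valuation

variable {L Γ : Type*} [Field L] [LinearOrderedCommGroupWithZero Γ] (w : Valuation L Γ)
  {n : ℕ} {a b x y : L}

/-- Roots of `X ^ (n + 1) + a X ^ n + b` are integral for any valuation at which `a`, `b` are. -/
theorem Valuation.le_one_of_pow_mul_add_add_eq_zero (ha : w a = 1) (hb : w b < 1)
    (hx : x ^ n * (x + a) + b = 0) : w x ≤ 1 := by
  by_contra! h
  have h1 : w (x + a) = w x := w.map_add_eq_of_lt_left (by rwa [ha])
  have h2 := congrArg w (eq_neg_of_add_eq_zero_left hx)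
  rw [map_mul, map_pow, h1, Valuation.map_neg] at h2
  have h3 : 1 ≤ w x ^ n * w x := one_le_mul (one_le_pow₀ h.le) h.le
  exact absurd (h2 ▸ h3) hb.not_ge

/-- The valuation of the non-unit roots of `X ^ (n + 1) + a X ^ n + b`. -/
theorem Valuation.pow_eq_of_pow_mul_add_add_eq_zero (ha : w a = 1)
    (hx : x ^ n * (x + a) + b = 0) (hx1 : w x < 1) : w x ^ n = w b := by
  have h1 : w (x + a) = 1 := by rw [w.map_add_eq_of_lt_right (by rwa [ha]), ha]
  have h2 := congrArg w (eq_neg_of_add_eq_zero_left hx)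
  rwa [map_mul, map_pow, h1, Valuation.map_neg, mul_one] at h2

/-- `X ^ (n + 1) + a X ^ n + b` has a root that is a unit when `a` is one. -/
theorem Valuation.exists_root_eq_one {f : L[X]} (hf : f = X ^ (n + 1) + C a * X ^ n + C b)
    (hn : n ≠ 0) (hsplit : f.Splits) (ha : w a = 1) (hb : w b < 1) : ∃ x ∈ f.roots, w x = 1 := by
  have hdeg : f.natDegree = n + 1 := by rw [hf]; compute_degree!
  have hmon : f.Monic := by rw [hf]; monicity!
  have hnext : f.nextCoeff = a := by
    rw [nextCoeff_of_natDegree_pos (by omega), hdeg, hf]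
    simp [coeff_X_pow, coeff_C, hn]
  by_contra! h
  have hlt (r : L) (hr : r ∈ f.roots) : w r < 1 := by
    have h0 := isRoot_of_mem_roots hr
    rw [hf] at h0
    simp only [IsRoot, eval_add, eval_mul, eval_pow, eval_X, eval_C] at h0
    exact lt_of_le_of_ne
      (w.le_one_of_pow_mul_add_add_eq_zero (n := n) ha hb (by linear_combination h0)) (h r hr)
  have hsum : ∀ s : Multiset L, (∀ r ∈ s, w r < 1) → w s.sum < 1 := fun s ↦ by
    induction s using Multiset.induction with
    | empty => simp
    | cons r s ih =>
      intro hs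
      rw [Multiset.sum_cons]
      exact w.map_add_lt (hs r (by simp)) (ih fun t ht ↦ hs t (by simp [ht]))
  have h1 := hsplit.nextCoeff_eq_neg_sum_roots_of_monic hmon
  have h2 := hsum _ hlt
  rw [← Valuation.map_neg, ← h1, hnext, ha] at h2
  exact h2.ne rfl

/-- At most one root of `X ^ (n + 1) + a X ^ n + b` is a unit for `w`. -/
theorem Valuation.eq_of_pow_mul_add_add_eq_zero (hb : w b < 1)
    (hx : x ^ n * (x + a) + b = 0) (hy : y ^ n * (y + a) + b = 0)
    (hx1 : w x = 1) (hy1 : w y = 1) : x = y := by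
  by_contra hne
  have hxy := sub_ne_zero.mpr hne
  have key : (x - y) * (x ^ n * y ^ n) =
      (x - y) * (b * ∑ i ∈ Finset.range n, x ^ i * y ^ (n - 1 - i)) := by
    have := (Commute.all x y).mul_geom_sum₂ n
    linear_combination y ^ n * hx - x ^ n * hy - b * this
  have h1 := congrArg w (mul_left_cancel₀ hxy key)
  have h2 : w (∑ i ∈ Finset.range n, x ^ i * y ^ (n - 1 - i)) ≤ 1 :=
    w.map_sum_le fun i _ ↦ by simp [hx1, hy1]
  simp only [map_mul, map_pow, hx1, hy1, one_pow, mul_one] at h1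
  exact absurd h1.symm (mul_lt_one_of_lt_of_le hb h2).ne

/-- The derivative of `X ^ (n + 2) + a X ^ (n + 1) + b` is a unit at a root that is a unit. -/
theorem Valuation.derivative_trinomial_eq_one (ha : w a = 1) (hb : w b < 1)
    (hx : x ^ (n + 1) * (x + a) + b = 0) (hx1 : w x = 1) :
    w (x ^ n * ((n + 2 : ℕ) * x + (n + 1 : ℕ) * a)) = 1 := by
  have h1 : w (x + a) < 1 := by
    have h2 := congrArg w (eq_neg_of_add_eq_zero_left hx)
    rw [map_mul, map_pow, hx1, one_pow, one_mul, Valuation.map_neg] at h2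
    rwa [h2]
  have h2 : ((n + 2 : ℕ) * x + (n + 1 : ℕ) * a : L) = (n + 2 : ℕ) * (x + a) + -a := by
    push_cast; ring
  have h3 : w ((n + 2 : ℕ) * (x + a)) < w (-a) := by
    rw [map_mul, Valuation.map_neg, ha]
    exact (mul_le_of_le_one_left zero_le (natCast_mem w.integer (n + 2))).trans_lt h1
  rw [map_mul, map_pow, hx1, h2, w.map_add_eq_of_lt_right h3, Valuation.map_neg, ha]
  simp

end Valuation

/-- An element of `𝓞 K` generating `K / F` whose minimal polynomial is separable modulo `q`
forces `q` to be unramified. -/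
theorem ramificationIdx'_eq_one_of_derivative_notMem {F K : Type*} [Field F] [NumberField F]
    [Field K] [NumberField K] [Algebra F K] (p : Ideal (𝓞 F)) [p.IsMaximal] (hp : p ≠ ⊥)
    (q : Ideal (𝓞 K)) [q.LiesOver p] (x : 𝓞 K) (hx : Algebra.adjoin F {(x : K)} = ⊤)
    (hq : aeval x (derivative (minpoly (𝓞 F) x)) ∉ q) : p.ramificationIdx' q = 1 := by
  refine Ideal.ramificationIdx'_spec ?_ fun h ↦ hq ?_
  · rw [pow_one, Ideal.map_le_iff_le_comap]
    exact (Ideal.over_def q p).le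
  · have := pow_sub_one_dvd_differentIdeal_aux (𝓞 F) F K q two_ne_zero hp (Ideal.dvd_iff_le.mpr h)
    rw [Nat.add_one_sub_one, pow_one] at this
    exact Ideal.dvd_iff_le.mp this (aeval_derivative_mem_differentIdeal (𝓞 F) F K x hx)

open IsDedekindDomain in
/-- If the conjugates of `y` all have valuation `w b / n` with `b ∈ K` of valuation `m` prime
to `n`, then `n` divides the degree of `y` over `K`. -/
theorem dvd_natDegree_minpoly_of_valuation {K L : Type*} [Field K] [NumberField K] [Field L]
    [NumberField L] [Algebra K L] (u : HeightOneSpectrum (𝓞 K)) (w : HeightOneSpectrum (𝓞 L))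
    [w.asIdeal.LiesOver u.asIdeal] {n m : ℕ} (hn : n ≠ 0) (hnm : n.Coprime m) {b : K}
    (hb : u.valuation K b = WithZero.exp (-(m : ℤ))) {y : L}
    (hsplit : ((minpoly K y).map (algebraMap K L)).Splits)
    (hw : ∀ r ∈ ((minpoly K y).map (algebraMap K L)).roots,
      w.valuation L r ^ n = w.valuation L (algebraMap K L b)) :
    n ∣ (minpoly K y).natDegree := by
  set h := minpoly K y with hh
  have hmon : h.Monic := minpoly.monic (Algebra.IsIntegral.isIntegral y)
  set c := h.coeff 0
  have hcard : Multiset.card (h.map (algebraMap K L)).roots = h.natDegree := by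
    rw [← hsplit.natDegree_eq_card_roots, natDegree_map]
  have h1 : w.valuation L (algebraMap K L c) ^ n =
      w.valuation L (algebraMap K L b) ^ h.natDegree := by
    have := hsplit.coeff_zero_eq_prod_roots_of_monic (hmon.map _)
    rw [coeff_map] at this
    rw [this, map_mul, map_pow, Valuation.map_neg, map_one, one_pow, one_mul, ← hcard,
      map_multiset_prod, ← Multiset.prod_map_pow]
    rw [Multiset.map_congr rfl hw, Multiset.map_const', Multiset.prod_replicate]
  rw [← HeightOneSpectrum.valuation_liesOver L u w, ← HeightOneSpectrum.valuation_liesOver L u w,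
    ← pow_mul, ← pow_mul, mul_comm, pow_mul, mul_comm, pow_mul] at h1
  have he : u.asIdeal.ramificationIdx' w.asIdeal ≠ 0 :=
    Ideal.IsDedekindDomain.ramificationIdx'_ne_zero_of_liesOver w.asIdeal u.ne_bot
  have h2 := (pow_left_inj₀ zero_le zero_le he).mp h1
  have hc : u.valuation K c ≠ 0 := fun h0 ↦ by
    simp only [h0, hb, zero_pow hn] at h2
    exact pow_ne_zero _ WithZero.exp_ne_zero h2.symm
  rw [← WithZero.exp_log hc, hb, ← WithZero.exp_nsmul, ← WithZero.exp_nsmul,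
    WithZero.exp_inj] at h2
  have h3 : (n : ℤ) ∣ (m * h.natDegree : ℕ) :=
    ⟨-WithZero.log (u.valuation K c), by push_cast; simp only [nsmul_eq_mul] at h2; linarith⟩
  exact hnm.dvd_of_dvd_mul_left (Int.natCast_dvd_natCast.mp h3)

/-- The roots of a trinomial other than a root in `K` that is a unit at `w` are conjugate
over `K`. -/
theorem exists_algEquiv_of_trinomial_roots {F K L : Type*} [Field F] [NumberField F] [Field K]
    [NumberField K] [Field L] [NumberField L] [Algebra F K] [Algebra K L] [Algebra F L]
    [IsScalarTower F K L] [Normal K L] (p : IsDedekindDomain.HeightOneSpectrum (𝓞 F))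
    (w : IsDedekindDomain.HeightOneSpectrum (𝓞 L)) [w.asIdeal.LiesOver p.asIdeal]
    {n m : ℕ} {A B : 𝓞 F} {f : (𝓞 F)[X]} (hf : f = X ^ (n + 2) + C A * X ^ (n + 1) + C B)
    (hirr : Irreducible (f.map (algebraMap (𝓞 F) F)))
    (hA : A ∉ p.asIdeal) (hBm : B ∈ p.asIdeal ^ m) (hBm' : B ∉ p.asIdeal ^ (m + 1)) (hm : m ≠ 0)
    (hnm : (n + 1).Coprime m) (x : K) (hxtop : Algebra.adjoin F {x} = ⊤)
    (hxL : aeval (algebraMap K L x) f = 0) (hxw : w.valuation L (algebraMap K L x) = 1) {y z : L}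
    (hy : aeval y f = 0) (hz : aeval z f = 0) (hyx : y ≠ algebraMap K L x)
    (hzx : z ≠ algebraMap K L x) : ∃ σ : L ≃ₐ[K] L, σ y = z := by
  have hdeg : f.natDegree = n + 2 := by rw [hf]; compute_degree!
  have haeval (r : L) (hr : aeval r f = 0) :
      r ^ (n + 1) * (r + algebraMap (𝓞 F) L A) + algebraMap (𝓞 F) L B = 0 := by
    rw [hf] at hr
    simp only [map_add, map_mul, map_pow, aeval_X, aeval_C] at hr
    linear_combination hr
  have hwF (a : 𝓞 F) : p.intValuation a ^ p.asIdeal.ramificationIdx' w.asIdeal =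
      w.valuation L (algebraMap (𝓞 F) L a) := by
    rw [IsScalarTower.algebraMap_apply (𝓞 F) F L, ← p.valuation_liesOver L w,
      p.valuation_of_algebraMap]
  have hvB : p.intValuation B = WithZero.exp (-(m : ℤ)) := by
    refine le_antisymm ((p.intValuation_le_pow_iff_mem B m).mpr hBm) ?_
    have h := (p.intValuation_le_pow_iff_mem B (m + 1)).not.mpr hBm'
    rw [not_le, ← WithZero.exp_log (p.intValuation_ne_zero B fun h0 ↦ hBm' (by simp [h0])),
      WithZero.exp_lt_exp] at h
    rw [← WithZero.exp_log (p.intValuation_ne_zero B fun h0 ↦ hBm' (by simp [h0])),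
      WithZero.exp_le_exp]
    push_cast at h
    omega
  have he : p.asIdeal.ramificationIdx' w.asIdeal ≠ 0 :=
    Ideal.IsDedekindDomain.ramificationIdx'_ne_zero_of_liesOver w.asIdeal p.ne_bot
  have hwA : w.valuation L (algebraMap (𝓞 F) L A) = 1 := by
    rw [← hwF, p.intValuation_eq_one_iff.mpr hA, one_pow]
  have hwB : w.valuation L (algebraMap (𝓞 F) L B) < 1 := by
    rw [← hwF]
    refine pow_lt_one₀ zero_le ?_ he
    rw [p.intValuation_lt_one_iff_mem]
    exact Ideal.pow_le_self hm hBm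
  have hmon : f.Monic := by rw [hf]; monicity!
  have : IsScalarTower (𝓞 F) K L := .of_algebraMap_eq fun a ↦ by
    rw [IsScalarTower.algebraMap_apply (𝓞 F) F L, IsScalarTower.algebraMap_apply (𝓞 F) F K,
      ← IsScalarTower.algebraMap_apply F K L]
  have hx : aeval x f = 0 := by
    rwa [aeval_algebraMap_apply, map_eq_zero_iff _ (algebraMap K L).injective] at hxL
  obtain ⟨x, rfl⟩ : ∃ x' : 𝓞 K, (x' : K) = x :=
    ⟨⟨x, isIntegral_trans (R := ℤ) (A := 𝓞 F) _ ⟨f, hmon, hx⟩⟩, rfl⟩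
  have hder : w.valuation L (aeval (algebraMap K L x) (derivative f)) = 1 := by
    rw [← Valuation.derivative_trinomial_eq_one _ hwA hwB (haeval _ hxL) hxw, hf]
    congr 1
    simp only [derivative_X_pow, derivative_C_mul, derivative_C, map_add, map_mul,
      map_pow, aeval_X, aeval_C, map_natCast, map_zero]
    push_cast
    ring
  let q : IsDedekindDomain.HeightOneSpectrum (𝓞 K) :=
    ⟨w.asIdeal.under (𝓞 K), inferInstance, Ideal.IsIntegral.comap_ne_bot _ w.ne_bot⟩
  have : w.asIdeal.LiesOver q.asIdeal := Ideal.over_under _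
  have : q.asIdeal.LiesOver p.asIdeal := Ideal.LiesOver.tower_bot w.asIdeal _ _
  have hmin : minpoly (𝓞 F) x = f := by
    refine map_injective _ (FaithfulSMul.algebraMap_injective (𝓞 F) F) ?_
    rw [← minpoly.isIntegrallyClosed_eq_field_fractions F K (Algebra.IsIntegral.isIntegral x)]
    refine (minpoly.eq_of_irreducible_of_monic hirr ?_ (hmon.map _)).symm
    rw [aeval_map_algebraMap, hx]
  have hqp : p.asIdeal.ramificationIdx' q.asIdeal = 1 := by
    have := p.isMaximal
    refine ramificationIdx'_eq_one_of_derivative_notMem _ p.ne_bot _ x hxtop ?_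
    rw [hmin]
    change algebraMap (𝓞 K) (𝓞 L) _ ∉ w.asIdeal
    rw [← w.valuation_eq_one_iff_notMem (K := L), ← hder, ← aeval_algebraMap_apply,
      ← aeval_algebraMap_apply]
    rfl
  have hbq : q.valuation K (algebraMap (𝓞 F) K B) = WithZero.exp (-(m : ℤ)) := by
    rw [IsScalarTower.algebraMap_apply (𝓞 F) F K, ← p.valuation_liesOver K q, hqp, pow_one,
      p.valuation_of_algebraMap, hvB]
  set fK := f.map (algebraMap (𝓞 F) K)
  have hxK : fK.IsRoot x := by
    rwa [IsRoot, eval_map_algebraMap]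
  set g := fK /ₘ (X - C (x : K))
  have hfg : (X - C (x : K)) * g = fK := mul_divByMonic_eq_iff_isRoot.mpr hxK
  have hgmon : g.Monic := (monic_X_sub_C _).of_mul_monic_left (by rw [hfg]; exact hmon.map _)
  have hgdeg : g.natDegree = n + 1 := by
    have := congrArg natDegree hfg
    rw [(monic_X_sub_C _).natDegree_mul hgmon, natDegree_X_sub_C, hmon.natDegree_map, hdeg] at this
    omega
  have hgroot (r : L) (hr : aeval r f = 0) (hrx : r ≠ algebraMap K L x) : aeval r g = 0 := by
    have := congrArg (aeval r) hfg
    rw [aeval_map_algebraMap, hr, map_mul, map_sub, aeval_X, aeval_C] at this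
    exact (mul_eq_zero.mp this).resolve_left (sub_ne_zero.mpr hrx)
  have hgsep : g.eval (x : K) ≠ 0 := fun h0 ↦ by
    have := congrArg (fun P ↦ eval (x : K) (derivative P)) hfg
    simp only [derivative_mul, eval_add, eval_mul, h0, eval_sub, eval_X, eval_C, sub_self,
      zero_mul, mul_zero, add_zero, fK, derivative_map, eval_map_algebraMap] at this
    rw [aeval_algebraMap_apply, ← this, map_zero, map_zero] at hder
    exact zero_ne_one hder
  have hdvd : minpoly K y ∣ g := minpoly.dvd _ _ (hgroot y hy hyx)
  have hyint : IsIntegral K y := Algebra.IsIntegral.isIntegral y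
  have hn : n + 1 ∣ (minpoly K y).natDegree := by
    refine dvd_natDegree_minpoly_of_valuation q w n.succ_ne_zero hnm hbq
      (Normal.splits inferInstance y) fun r hr ↦ ?_
    have hr0 : aeval r g = 0 := by
      refine aeval_eq_zero_of_dvd_aeval_eq_zero hdvd ?_
      rw [← eval_map_algebraMap]
      exact isRoot_of_mem_roots hr
    have hrf : aeval r f = 0 := by
      rw [← aeval_map_algebraMap K]
      change aeval r fK = 0
      rw [← hfg, map_mul, hr0, mul_zero]
    have hrx : r ≠ algebraMap K L x := by
      rintro rfl
      rw [aeval_algebraMap_apply, map_eq_zero_iff _ (algebraMap K L).injective] at hr0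
      exact hgsep (by rwa [coe_aeval_eq_eval] at hr0)
    rw [← IsScalarTower.algebraMap_apply]
    refine Valuation.pow_eq_of_pow_mul_add_add_eq_zero _ hwA (haeval r hrf) ?_
    refine lt_of_le_of_ne
      (Valuation.le_one_of_pow_mul_add_add_eq_zero _ hwA hwB (haeval r hrf)) fun h1 ↦ hrx ?_
    exact Valuation.eq_of_pow_mul_add_add_eq_zero _ hwB (haeval r hrf) (haeval _ hxL) h1 hxw
  have hgy : g = minpoly K y := eq_of_monic_of_dvd_of_natDegree_le (minpoly.monic hyint) hgmon
    hdvd (hgdeg ▸ Nat.le_of_dvd (minpoly.natDegree_pos hyint) hn)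
  have hconj : IsConjRoot K y z := isConjRoot_of_aeval_eq_zero hyint (hgy ▸ hgroot z hz hzx)
  exact hconj.symm.exists_algEquiv

/-- Let `F` be a number field, `d ≥ 3`, and
`f(x) = x^d + A·x^{d-1} + B ∈ O_F[x]` irreducible over `F`, with splitting field `L`.
Suppose a nonzero prime `𝔭` of `O_F` divides `(B)` but not `(A)` and satisfies
`gcd(d-1, v_𝔭(B)) = 1` (where `v_𝔭(B)` is the unique `m` with `B ∈ 𝔭^m \ 𝔭^{m+1}`).
Then `Gal(L/F)` contains a subgroup acting transitively on `d-1` of the roots of `f` and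
fixing the remaining root; in particular its action on the roots of `f` is doubly
transitive. -/
theorem stmt_14 (F L : Type*) [Field F] [NumberField F] [Field L] [NumberField L]
    [Algebra F L]
    (d : ℕ) (hd : 3 ≤ d)
    (A B : 𝓞 F) (f : Polynomial (𝓞 F))
    (hf : f = X ^ d + C A * X ^ (d - 1) + C B)
    (hirr : Irreducible (f.map (algebraMap (𝓞 F) F)))
    (hL : Polynomial.IsSplittingField F L (f.map (algebraMap (𝓞 F) F)))
    (𝔭 : Ideal (𝓞 F)) (h𝔭prime : 𝔭.IsPrime) (h𝔭ne : 𝔭 ≠ ⊥)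
    (hB : B ∈ 𝔭) (hA : A ∉ 𝔭)
    (hval : ∃ m : ℕ, B ∈ 𝔭 ^ m ∧ B ∉ 𝔭 ^ (m + 1) ∧ Nat.gcd (d - 1) m = 1) :
    (∃ x₀ ∈ (f.map (algebraMap (𝓞 F) F)).rootSet L,
      ∀ y ∈ (f.map (algebraMap (𝓞 F) F)).rootSet L,
        ∀ z ∈ (f.map (algebraMap (𝓞 F) F)).rootSet L,
          y ≠ x₀ → z ≠ x₀ → ∃ σ : L ≃ₐ[F] L, σ x₀ = x₀ ∧ σ y = z) ∧
    (∀ x₁ ∈ (f.map (algebraMap (𝓞 F) F)).rootSet L,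
      ∀ x₂ ∈ (f.map (algebraMap (𝓞 F) F)).rootSet L,
        ∀ y₁ ∈ (f.map (algebraMap (𝓞 F) F)).rootSet L,
          ∀ y₂ ∈ (f.map (algebraMap (𝓞 F) F)).rootSet L,
            x₁ ≠ x₂ → y₁ ≠ y₂ → ∃ σ : L ≃ₐ[F] L, σ x₁ = y₁ ∧ σ x₂ = y₂) := by
  obtain ⟨n, rfl⟩ : ∃ n, d = n + 2 := ⟨d - 2, by omega⟩
  obtain ⟨m, hBm, hBm', hnm⟩ := hval
  have hm : m ≠ 0 := by
    rintro rfl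
    exact hBm' (by simpa using hB)
  have hmon : f.Monic := by rw [hf]; monicity!
  have hmem (x : L) : x ∈ (f.map (algebraMap (𝓞 F) F)).rootSet L ↔ aeval x f = 0 := by
    rw [mem_rootSet, aeval_map_algebraMap, and_iff_right hirr.ne_zero]
  simp only [hmem]
  have : IsGalois F L := IsGalois.of_separable_splitting_field hirr.separable
  let p : IsDedekindDomain.HeightOneSpectrum (𝓞 F) := ⟨𝔭, h𝔭prime, h𝔭ne⟩
  obtain ⟨P, hPprime, hPover⟩ : ∃ P : Ideal (𝓞 L), P.IsPrime ∧ P.LiesOver 𝔭 := by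
    obtain ⟨⟨P, h1, h2⟩⟩ := 𝔭.nonempty_primesOver (S := 𝓞 L)
    exact ⟨P, h1, h2⟩
  let w : IsDedekindDomain.HeightOneSpectrum (𝓞 L) :=
    ⟨P, hPprime, Ideal.ne_bot_of_liesOver_of_ne_bot h𝔭ne P⟩
  have : w.asIdeal.LiesOver p.asIdeal := hPover
  have hwA : w.valuation L (algebraMap (𝓞 F) L A) = 1 := by
    rw [IsScalarTower.algebraMap_apply (𝓞 F) (𝓞 L) L, w.valuation_eq_one_iff_notMem]
    exact fun h ↦ hA ((Ideal.mem_of_liesOver P 𝔭 A).mpr h)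
  have hwB : w.valuation L (algebraMap (𝓞 F) L B) < 1 := by
    rw [IsScalarTower.algebraMap_apply (𝓞 F) (𝓞 L) L]
    exact (w.valuation_lt_one_iff_mem _).mpr ((Ideal.mem_of_liesOver P 𝔭 B).mp hB)
  obtain ⟨x₀, hx₀, hwx₀⟩ : ∃ x₀ : L, aeval x₀ f = 0 ∧ w.valuation L x₀ = 1 := by
    have hsplit : (f.map (algebraMap (𝓞 F) L)).Splits := by
      have := hL.splits'
      rwa [map_map, ← IsScalarTower.algebraMap_eq] at this
    obtain ⟨x, hx, hx1⟩ := (w.valuation L).exists_root_eq_one (n := n + 1)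
      (by simp [hf]) n.succ_ne_zero hsplit hwA hwB
    exact ⟨x, by simpa using isRoot_of_mem_roots hx, hx1⟩
  have htrans (x y : L) (hx : aeval x f = 0) (hy : aeval y f = 0) : ∃ σ : L ≃ₐ[F] L, σ x = y := by
    have hxF : minpoly F x = f.map (algebraMap (𝓞 F) F) :=
      (minpoly.eq_of_irreducible_of_monic hirr (by rwa [aeval_map_algebraMap]) (hmon.map _)).symm
    exact (isConjRoot_of_aeval_eq_zero (Algebra.IsIntegral.isIntegral x)
      (by rwa [hxF, aeval_map_algebraMap])).symm.exists_algEquiv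
  have hstab (y z : L) (hy : aeval y f = 0) (hz : aeval z f = 0) (hyx : y ≠ x₀) (hzx : z ≠ x₀) :
      ∃ σ : L ≃ₐ[F] L, σ x₀ = x₀ ∧ σ y = z := by
    let x : IntermediateField.adjoin F {x₀} := IntermediateField.AdjoinSimple.gen F x₀
    have htop : Algebra.adjoin F {x} = ⊤ := by
      exact (IntermediateField.adjoin.powerBasis
        (Algebra.IsIntegral.isIntegral (R := F) x₀)).adjoin_gen_eq_top
    obtain ⟨σ, hσ⟩ := exists_algEquiv_of_trinomial_roots (K := IntermediateField.adjoin F {x₀}) p w hf hirr hA hBm hBm' hm hnm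
      x htop hx₀ hwx₀ hy hz hyx hzx
    exact ⟨σ.restrictScalars F, σ.commutes x, hσ⟩
  refine ⟨⟨x₀, hx₀, fun y hy z hz hyx hzx ↦ hstab y z hy hz hyx hzx⟩, ?_⟩
  intro x₁ hx₁ x₂ hx₂ y₁ hy₁ y₂ hy₂ hx hy
  have hroot (σ : L ≃ₐ[F] L) (x : L) (hx : aeval x f = 0) : aeval (σ x) f = 0 := by
    rw [← aeval_map_algebraMap F] at hx ⊢
    rw [aeval_algHom_apply, hx, map_zero]
  obtain ⟨τ, hτ⟩ := htrans x₁ x₀ hx₁ hx₀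
  obtain ⟨ρ, hρ⟩ := htrans y₁ x₀ hy₁ hx₀
  obtain ⟨σ, hσ, hσ'⟩ := hstab (τ x₂) (ρ y₂) (hroot τ x₂ hx₂) (hroot ρ y₂ hy₂)
    (hτ ▸ τ.injective.ne hx.symm) (hρ ▸ ρ.injective.ne hy.symm)
  exact ⟨(τ.trans σ).trans ρ.symm, by simp [hτ, hσ, AlgEquiv.symm_apply_eq, hρ], by simp [hσ']⟩
end

section
/- Let d ≥ 3 and let c be a positive integer, and let φ(x) = x^d − cd·x^{d−1} + c(d−1) ∈ ℤ[x]. Then for every n ≥ 3, |φ^{n+1}(0)| ≥ (c(d−1))^{(d−1)^{n−3}}. In particular, the forward orbit of 0 under φ is infinite: the values φ^n(0), n ≥ 0, are pairwise distinct. -/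
open Polynomial

/-- Far from the origin, `x ↦ x ^ (k + 1) * (x - b) + A` grows at least like `|x| ^ (k + 1)`. -/
theorem pow_abs_le_abs_pow_mul_sub_add {k : ℕ} {A b x : ℤ} (hA : 0 ≤ A) (hAx : A ≤ |x|)
    (hx : 1 ≤ |x|) (hb : 2 ≤ |x - b|) :
    |x| ^ (k + 1) ≤ |x ^ (k + 1) * (x - b) + A| := by
  have h1 : |x| ≤ |x| ^ (k + 1) := le_self_pow₀ hx (by omega)
  have h2 : |x ^ (k + 1) * (x - b)| - |A| ≤ |x ^ (k + 1) * (x - b) + A| := by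
    simpa using abs_sub_abs_le_abs_sub (x ^ (k + 1) * (x - b)) (-A)
  rw [abs_mul, abs_pow, abs_of_nonneg hA] at h2
  nlinarith

/-- A sequence with `a 0 = 0`, iterating `x ↦ x ^ (k + 2) * (x - c (k + 3)) + c (k + 2)`:
its first values, and growth from the third one on. -/
theorem orbit_growth {k : ℕ} {c : ℤ} (hc : 1 ≤ c) {a : ℕ → ℤ} (h0 : a 0 = 0)
    (hs : ∀ n, a (n + 1) = a n ^ (k + 2) * (a n - c * (k + 3)) + c * (k + 2)) :
    a 1 = c * (k + 2) ∧ a 2 ≤ -(c * (k + 2)) ∧ |a 2| < |a 3| ∧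
      ∀ n, c * (k + 3) + 2 ≤ |a (n + 3)| ∧ |a (n + 3)| ^ (k + 2) ≤ |a (n + 4)| ∧
        |a (n + 3)| < |a (n + 4)| := by
  have hk : (0 : ℤ) ≤ k := Int.natCast_nonneg k
  have hA : 2 ≤ c * (k + 2) := by nlinarith
  have h1 : a 1 = c * (k + 2) := by simp [hs 0, h0]
  have h2 : a 2 ≤ -(c * (k + 2)) := by
    have h := hs 1
    rw [h1] at h
    have hp : (1 : ℤ) ≤ (c * (k + 2)) ^ k := one_le_pow₀ (by linarith)
    have e : a 2 = c * (k + 2) * (1 - c * (c * (k + 2)) * (c * (k + 2)) ^ k) := by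
      rw [h]; ring
    have hq : 2 ≤ c * (c * (k + 2)) * (c * (k + 2)) ^ k := by
      have : 2 ≤ c * (c * (k + 2)) := by nlinarith
      nlinarith
    rw [e]
    nlinarith
  have h3 : c * (k + 3) + 2 ≤ |a 3| ∧ |a 2| < |a 3| := by
    have e2 : |a 2| = -a 2 := abs_of_nonpos (by linarith)
    have hl : |a 2| ≤ |a 2| ^ (k + 2) := le_self_pow₀ (by linarith) (by omega)
    have e3 : |a 2 - c * (k + 3)| = |a 2| + c * (k + 3) := by
      rw [abs_of_nonpos (by nlinarith), e2]; ring
    have h := abs_sub_abs_le_abs_sub (a 2 ^ (k + 2) * (a 2 - c * (k + 3))) (-(c * (k + 2)))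
    rw [sub_neg_eq_add, ← hs 2, abs_neg, abs_mul, abs_pow, e3,
      abs_of_nonneg (by linarith : 0 ≤ c * ((k : ℤ) + 2))] at h
    have hd : 3 ≤ c * ((k : ℤ) + 3) := by nlinarith
    have hm : |a 2| * (|a 2| + c * (k + 3)) ≤ |a 2| ^ (k + 2) * (|a 2| + c * (k + 3)) :=
      mul_le_mul_of_nonneg_right hl (by linarith [abs_nonneg (a 2)])
    have hB : c * (k + 2) ≤ |a 2| := by linarith
    have hlow : |a 2| * (c * (k + 3) + 1) ≤ |a 3| := by
      simp only [Nat.reduceAdd] at h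
      nlinarith
    constructor <;> nlinarith
  have step : ∀ n, c * (k + 3) + 2 ≤ |a n| →
      |a n| ^ (k + 2) ≤ |a (n + 1)| ∧ |a n| < |a (n + 1)| := by
    intro n hn
    have hb : 2 ≤ |a n - c * (k + 3)| := by
      have h := abs_sub_abs_le_abs_sub (a n) (c * (k + 3))
      rw [abs_of_nonneg (by nlinarith : 0 ≤ c * ((k : ℤ) + 3))] at h
      linarith
    have h := pow_abs_le_abs_pow_mul_sub_add (k := k + 1) (by linarith : 0 ≤ c * ((k : ℤ) + 2))
      (by nlinarith) (by nlinarith) hb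
    rw [show k + 1 + 1 = k + 2 from rfl, ← hs n] at h
    exact ⟨h, (lt_self_pow₀ (by nlinarith) (by omega)).trans_le h⟩
  refine ⟨h1, h2, h3.2, fun n => ?_⟩
  have hn : c * (k + 3) + 2 ≤ |a (n + 3)| := by
    induction n with
    | zero => exact h3.1
    | succ n ih => exact ih.trans (by simpa [add_right_comm] using (step _ ih).2.le)
  exact ⟨hn, step _ hn⟩

/-- For `d ≥ 3`, `c ≥ 1` and `φ(x) = x^d - cd·x^{d-1} + c(d-1)`:
for every `n ≥ 3` one has `|φ^{n+1}(0)| ≥ (c(d-1))^((d-1)^(n-3))`; in particular the forward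
orbit of `0` under `φ` is infinite (the values `φ^n(0)` are pairwise distinct). -/
theorem stmt_15 (d c : ℕ) (hd : 3 ≤ d) (hc : 0 < c)
    (φ : Polynomial ℤ)
    (hφ : φ = X ^ d - C ((c : ℤ) * d) * X ^ (d - 1) + C ((c : ℤ) * ((d : ℤ) - 1))) :
    (∀ n : ℕ, 3 ≤ n →
      ((c : ℤ) * ((d : ℤ) - 1)) ^ ((d - 1) ^ (n - 3)) ≤ |(polyIter φ (n + 1)).eval 0|) ∧
      ∀ m n : ℕ, (polyIter φ m).eval 0 = (polyIter φ n).eval 0 → m = n := by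
  obtain ⟨k, rfl⟩ := Nat.exists_eq_add_of_le' hd
  have hc' : (1 : ℤ) ≤ c := by exact_mod_cast hc
  have hs : ∀ n, (polyIter φ (n + 1)).eval 0 = (polyIter φ n).eval 0 ^ (k + 2) *
      ((polyIter φ n).eval 0 - c * (k + 3)) + c * (k + 2) := by
    intro n
    rw [polyIter, eval_comp, hφ]
    simp only [eval_add, eval_sub, eval_mul, eval_pow, eval_X, eval_C,
      show k + 3 - 1 = k + 2 from rfl]
    push_cast
    ring
  have h0 : (polyIter φ 0).eval 0 = 0 := by simp [polyIter]
  generalize ha : (fun n => (polyIter φ n).eval 0) = a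
  have ha' : ∀ n, (polyIter φ n).eval 0 = a n := fun n => congrFun ha n
  simp only [ha'] at hs h0 ⊢
  obtain ⟨h1, h2, h23, hg⟩ := orbit_growth hc' h0 hs
  have hk : (0 : ℤ) ≤ k := Int.natCast_nonneg k
  have hA : 2 ≤ (c : ℤ) * (k + 2) := by nlinarith
  constructor
  · intro n hn
    obtain ⟨j, rfl⟩ := Nat.exists_eq_add_of_le' hn
    have e : (c : ℤ) * (((k + 3 : ℕ) : ℤ) - 1) = c * (k + 2) := by push_cast; ring
    rw [e, show k + 3 - 1 = k + 2 from rfl, Nat.add_sub_cancel]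
    induction j with
    | zero =>
      have := hg 0
      simp only [zero_add, pow_zero, pow_one] at this ⊢
      nlinarith
    | succ j ih =>
      have h := (hg (j + 1)).2.1
      rw [pow_succ (k + 2) j, pow_mul]
      exact (pow_le_pow_left₀ (by positivity) (ih (by omega)) _).trans
        (by simpa [add_assoc, add_comm, add_left_comm] using h)
  · have hmono : StrictMono fun n => |a (n + 2)| := by
      refine strictMono_nat_of_lt_succ fun n => ?_
      cases n with
      | zero => exact h23
      | succ n => exact (hg n).2.2
    have h2' : (c : ℤ) * (k + 2) ≤ |a 2| := by linarith [neg_le_abs (a 2)]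
    have hlow : ∀ n, (c : ℤ) * (k + 2) ≤ |a (n + 2)| := fun n =>
      h2'.trans (hmono.monotone (Nat.zero_le n))
    have hne0 : ∀ n, a (n + 2) ≠ 0 := fun n h => by
      have := hlow n
      rw [h, abs_zero] at this
      linarith
    have hne1 : ∀ n, a (n + 2) ≠ a 1 := fun n h => by
      cases n with
      | zero => rw [zero_add] at h; linarith
      | succ n =>
        have := hmono (Nat.succ_pos n)
        simp only [Nat.succ_eq_add_one, h, h1, zero_add] at this
        rw [abs_of_nonneg (by linarith : 0 ≤ (c : ℤ) * (k + 2))] at this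
        linarith
    intro m n h
    match m, n, h with
    | 0, 0, _ => rfl
    | 1, 1, _ => rfl
    | 0, 1, h => linarith
    | 1, 0, h => linarith
    | 0, n + 2, h => exact absurd (h.symm.trans h0) (hne0 n)
    | n + 2, 0, h => exact absurd (h.trans h0) (hne0 n)
    | 1, n + 2, h => exact absurd h.symm (hne1 n)
    | n + 2, 1, h => exact absurd h (hne1 n)
    | m + 2, n + 2, h => rw [hmono.injective (congrArg abs h)]
end
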